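/- Let ι be a finite index type of cell labels and κ a finite index type of demand labels. Fix cells i, u, j, e ∈ ι, a coefficient β_u ≥ 0, lengths l_i > 0 and l_j > 0, γ ≥ 0, and Δt ≥ 0 with Δt·γ ≤ l_i and Δt·γ ≤ l_j. Let d : ℝ → ℝ be nondecreasing and γ-Lipschitz, let s : ℝ → ℝ be nonincreasing and γ-Lipschitz, let v_e ∈ ℝ be a fixed threshold, let p : κ → ℝ be nonnegative, and let C ⊆ ι have nonnegative weights a_c ≥ 0 and fixed thresholds v_c ∈ ℝ. Define G : (ι → ℝ) × (κ → ℝ) → ℝ by G(z, w) := max{ z_i − Δt·d((z_i − β_u z_u)/l_i), z_i − Δt·s((z_j − z_i)/l_j) + max{0, z_e − v_e} } + Σ_{r∈κ} p_r w_r + Σ_{c∈C} a_c · max{0, z_c − v_c}. Then G is monotone: z ≤ z' componentwise and w ≤ w' componentwise imply G(z, w) ≤ G(z', w'). -/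

import Mathlib

theorem lip_step (f : ℝ → ℝ) (γ Δt l δ x y : ℝ) (hl : 0 < l) (hΔt : 0 ≤ Δt)
    (hc : Δt * γ ≤ l) (hδ : 0 ≤ δ) (hf : ∀ x y : ℝ, |f x - f y| ≤ γ * |x - y|)
    (hxy : |y - x| = δ / l) : Δt * (f y - f x) ≤ δ := by
  have h1 : f y - f x ≤ γ * (δ / l) := by
    have := hf y x
    rw [hxy] at this
    exact (le_abs_self _).trans this
  have h0 : 0 ≤ δ / l := by positivity
  calc Δt * (f y - f x) ≤ Δt * (γ * (δ / l)) := mul_le_mul_of_nonneg_left h1 hΔt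
    _ = (Δt * γ) * (δ / l) := by ring
    _ ≤ l * (δ / l) := mul_le_mul_of_nonneg_right hc h0
    _ = δ := by field_simp

/-- monotonicity verification for paper Proposition 1, ramp
metering: for a mainline cell `i` immediately upstream of an asymmetric
onramp-merging junction with controlled onramp cell `e` and downstream cell `j`,
the transformed state update
`G(z, w) = max{ z_i − Δt·d((z_i − β_u z_u)/l_i),
                z_i − Δt·s((z_j − z_i)/l_j) + max{0, z_e − v_e} }
  + Σ_r p_r w_r + Σ_{c∈C} a_c·max{0, z_c − v_c}`
is monotone in the transformed state `z` and the external demand `w`, provided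
`d` is nondecreasing and `γ`-Lipschitz, `s` is nonincreasing and `γ`-Lipschitz,
`β_u ≥ 0`, `p ≥ 0`, the weights `a_c` are nonnegative, and `Δt·γ ≤ l_i`,
`Δt·γ ≤ l_j`. -/
theorem tctm_asymmetric_mainline_update_monotone
    (ι κ : Type*) [Fintype ι] [Fintype κ]
    (i u j e : ι) (βu : ℝ) (hβu : 0 ≤ βu)
    (li lj : ℝ) (hli : 0 < li) (hlj : 0 < lj)
    (γ : ℝ) (hγ : 0 ≤ γ)
    (Δt : ℝ) (hΔt : 0 ≤ Δt) (hΔtli : Δt * γ ≤ li) (hΔtlj : Δt * γ ≤ lj)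
    (d : ℝ → ℝ) (hd : Monotone d) (hdLip : ∀ x y : ℝ, |d x - d y| ≤ γ * |x - y|)
    (s : ℝ → ℝ) (hs : Antitone s) (hsLip : ∀ x y : ℝ, |s x - s y| ≤ γ * |x - y|)
    (ve : ℝ) (p : κ → ℝ) (hp : ∀ r, 0 ≤ p r)
    (C : Finset ι) (a : ι → ℝ) (ha : ∀ c ∈ C, 0 ≤ a c) (v : ι → ℝ)
    (z z' : ι → ℝ) (w w' : κ → ℝ) (hz : ∀ x, z x ≤ z' x) (hw : ∀ r, w r ≤ w' r) :
    max (z i - Δt * d ((z i - βu * z u) / li))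
        (z i - Δt * s ((z j - z i) / lj) + max 0 (z e - ve))
      + (∑ r, p r * w r) + ∑ c ∈ C, a c * max 0 (z c - v c)
    ≤ max (z' i - Δt * d ((z' i - βu * z' u) / li))
        (z' i - Δt * s ((z' j - z' i) / lj) + max 0 (z' e - ve))
      + (∑ r, p r * w' r) + ∑ c ∈ C, a c * max 0 (z' c - v c) := by
  have hδ : 0 ≤ z' i - z i := sub_nonneg.2 (hz i)
  have hD := lip_step d γ Δt li (z' i - z i) ((z i - βu * z u) / li)
    ((z' i - βu * z u) / li) hli hΔt hΔtli hδ hdLip (by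
      rw [← sub_div, abs_div, abs_of_pos hli]
      congr 1
      rw [← abs_of_nonneg hδ]
      congr 1
      ring)
  have hS := lip_step s γ Δt lj (z' i - z i) ((z j - z i) / lj)
    ((z j - z' i) / lj) hlj hΔt hΔtlj hδ hsLip (by
      rw [← sub_div, abs_div, abs_of_pos hlj]
      congr 1
      rw [← abs_of_nonneg hδ, ← abs_neg]
      congr 1
      ring)
  have hD' : Δt * d ((z' i - βu * z' u) / li) ≤ Δt * d ((z' i - βu * z u) / li) := by
    refine mul_le_mul_of_nonneg_left (hd ?_) hΔt
    have := mul_le_mul_of_nonneg_left (hz u) hβu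
    gcongr
    all_goals exact hz u
  have hS' : Δt * s ((z' j - z' i) / lj) ≤ Δt * s ((z j - z' i) / lj) := by
    refine mul_le_mul_of_nonneg_left (hs ?_) hΔt
    gcongr
    all_goals exact hz j
  refine add_le_add (add_le_add (max_le_max ?_ (add_le_add ?_ ?_)) ?_) ?_
  · linarith
  · linarith
  · exact max_le_max le_rfl (sub_le_sub_right (hz e) _)
  · exact Finset.sum_le_sum fun r _ => mul_le_mul_of_nonneg_left (hw r) (hp r)
  · exact Finset.sum_le_sum fun c hc => mul_le_mul_of_nonneg_left
      (max_le_max le_rfl (sub_le_sub_right (hz c) _)) (ha c hc)
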